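/- In the convex model on n ≥ 3 vertices, let e_2(n) be the maximum number of diagonals such that each chosen diagonal is crossed by at most two other chosen diagonals. Then e_2(n) = 2(n−3) + 1 if n ≡ 2 (mod 3), and e_2(n) = 2(n−3) otherwise. -/

import Mathlib

/-- A diagonal of the convex n-gon with vertices v_1,…,v_n: a pair (a,b) with
1 ≤ a < b ≤ n that is not a side of the polygon. -/
def IsDiag (n : ℕ) (p : ℕ × ℕ) : Prop :=
  1 ≤ p.1 ∧ p.1 < p.2 ∧ p.2 ≤ n ∧ p.2 - p.1 ≠ 1 ∧ ¬(p.1 = 1 ∧ p.2 = n)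

instance (n : ℕ) (p : ℕ × ℕ) : Decidable (IsDiag n p) := by
  unfold IsDiag; infer_instance

/-- Two diagonals v_a v_b (a<b) and v_c v_d (c<d) cross iff a<c<b<d or c<a<d<b. -/
def Crosses (p q : ℕ × ℕ) : Prop :=
  (p.1 < q.1 ∧ q.1 < p.2 ∧ p.2 < q.2) ∨ (q.1 < p.1 ∧ p.1 < q.2 ∧ q.2 < p.2)

instance (p q : ℕ × ℕ) : Decidable (Crosses p q) := by
  unfold Crosses; infer_instance

/-- The set of diagonals has local crossing number at most ℓ:
each chosen diagonal is crossed by at most ℓ other chosen diagonals. -/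
def LcnLE (G : Finset (ℕ × ℕ)) (ℓ : ℕ) : Prop :=
  ∀ d ∈ G, (G.filter (fun d' => Crosses d d')).card ≤ ℓ

/-- All diagonals of the convex n-gon. -/
def allDiags (n : ℕ) : Finset (ℕ × ℕ) :=
  ((Finset.Icc 1 n) ×ˢ (Finset.Icc 1 n)).filter (fun p => IsDiag n p)

/-- Extend a configuration on `n` vertices by gluing a pentagram along the side `v_1 v_n`. -/
def gluePentagram (n : ℕ) (G : Finset (ℕ × ℕ)) : Finset (ℕ × ℕ) :=
  G ∪ {(1, n), (1, n + 1), (1, n + 2), (n, n + 2), (n, n + 3), (n + 1, n + 3)}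

theorem isDiag_gluePentagram {n : ℕ} (hn : 3 ≤ n) {G : Finset (ℕ × ℕ)}
    (hG : ∀ p ∈ G, IsDiag n p) : ∀ p ∈ gluePentagram n G, IsDiag (n + 3) p := by
  intro p hp
  rw [gluePentagram, Finset.mem_union] at hp
  rcases hp with hp | hp
  · have := hG p hp
    unfold IsDiag at *
    omega
  · simp only [Finset.mem_insert, Finset.mem_singleton] at hp
    unfold IsDiag
    rcases hp with rfl | rfl | rfl | rfl | rfl | rfl <;> simp only <;> omega

theorem card_gluePentagram {n : ℕ} (hn : 3 ≤ n) {G : Finset (ℕ × ℕ)}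
    (hG : ∀ p ∈ G, IsDiag n p) : (gluePentagram n G).card = G.card + 6 := by
  rw [gluePentagram, Finset.card_union_of_disjoint]
  · congr 1
    repeat rw [Finset.card_insert_of_notMem (by
      simp only [Finset.mem_insert, Finset.mem_singleton, Prod.mk.injEq]; omega)]
    rfl
  · rw [Finset.disjoint_left]
    intro p hp hq
    have := hG p hp
    simp only [Finset.mem_insert, Finset.mem_singleton, Prod.ext_iff] at hq
    unfold IsDiag at this
    omega

theorem lcnLE_gluePentagram {n : ℕ} {G : Finset (ℕ × ℕ)}
    (hG : ∀ p ∈ G, IsDiag n p) (h : LcnLE G 2) : LcnLE (gluePentagram n G) 2 := by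
  intro d hd
  rw [gluePentagram, Finset.mem_union] at hd
  rcases hd with hd | hd
  · refine (Finset.card_le_card ?_).trans (h d hd)
    intro p hp
    rw [Finset.mem_filter, gluePentagram, Finset.mem_union] at hp
    obtain ⟨hp | hp, hc⟩ := hp
    · exact Finset.mem_filter.2 ⟨hp, hc⟩
    · exfalso
      have := hG d hd
      simp only [Finset.mem_insert, Finset.mem_singleton] at hp
      unfold IsDiag at this
      unfold Crosses at hc
      rcases hp with rfl | rfl | rfl | rfl | rfl | rfl <;> simp only at hc <;> omega
  · have key : ∀ s : Finset (ℕ × ℕ), s.card ≤ 2 →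
        (∀ p, (IsDiag n p ∨ p = (1, n) ∨ p = (1, n + 1) ∨ p = (1, n + 2) ∨ p = (n, n + 2) ∨
          p = (n, n + 3) ∨ p = (n + 1, n + 3)) → Crosses d p → p ∈ s) →
        ((gluePentagram n G).filter (fun d' => Crosses d d')).card ≤ 2 := by
      intro s hs hsub
      refine (Finset.card_le_card ?_).trans hs
      intro p hp
      rw [Finset.mem_filter, gluePentagram, Finset.mem_union] at hp
      simp only [Finset.mem_insert, Finset.mem_singleton] at hp
      exact hsub p (hp.1.imp_left (hG p)) hp.2
    simp only [Finset.mem_insert, Finset.mem_singleton] at hd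
    unfold IsDiag Crosses at key
    rcases hd with rfl | rfl | rfl | rfl | rfl | rfl
    · apply key ∅ (by simp)
      rintro p (hp | rfl | rfl | rfl | rfl | rfl | rfl) hc <;> (simp at hc ⊢; try omega)
    · apply key {(n, n + 2), (n, n + 3)} Finset.card_le_two
      rintro p (hp | rfl | rfl | rfl | rfl | rfl | rfl) hc <;> (simp at hc ⊢; try omega)
    · apply key {(n, n + 3), (n + 1, n + 3)} Finset.card_le_two
      rintro p (hp | rfl | rfl | rfl | rfl | rfl | rfl) hc <;> (simp at hc ⊢; try omega)
    · apply key {(1, n + 1), (n + 1, n + 3)} Finset.card_le_two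
      rintro p (hp | rfl | rfl | rfl | rfl | rfl | rfl) hc <;> (simp at hc ⊢; try omega)
    · apply key {(1, n + 1), (1, n + 2)} Finset.card_le_two
      rintro p (hp | rfl | rfl | rfl | rfl | rfl | rfl) hc <;> (simp at hc ⊢; try omega)
    · apply key {(1, n + 2), (n, n + 2)} Finset.card_le_two
      rintro p (hp | rfl | rfl | rfl | rfl | rfl | rfl) hc <;> (simp at hc ⊢; try omega)

theorem exists_lcnLE_two_card_eq (n : ℕ) (hn : 3 ≤ n) :
    ∃ G : Finset (ℕ × ℕ), (∀ p ∈ G, IsDiag n p) ∧ LcnLE G 2 ∧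
      G.card = 2 * (n - 3) + (if n % 3 = 2 then 1 else 0) := by
  induction n using Nat.strong_induction_on with
  | _ n ih =>
    by_cases h6 : n < 6
    · interval_cases n
      · exact ⟨∅, by simp [LcnLE]⟩
      · exact ⟨{(1, 3), (2, 4)}, by decide, by unfold LcnLE; decide, by decide⟩
      · exact ⟨{(1, 3), (1, 4), (2, 4), (2, 5), (3, 5)}, by decide, by unfold LcnLE; decide,
          by decide⟩
    · obtain ⟨m, rfl⟩ : ∃ m, n = m + 3 := ⟨n - 3, by omega⟩
      obtain ⟨G, hG, hl, hc⟩ := ih m (by omega) (by omega)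
      refine ⟨gluePentagram m G, isDiag_gluePentagram (by omega) hG,
        lcnLE_gluePentagram hG hl, ?_⟩
      rw [card_gluePentagram (by omega) hG, hc]
      split_ifs <;> omega

/-- A diagonal of the convex polygon whose vertices are the elements of `V`, in their order. -/
def IsDiagOf (V : Finset ℕ) (p : ℕ × ℕ) : Prop :=
  p.1 ∈ V ∧ p.2 ∈ V ∧ p.1 < p.2 ∧ (∃ u ∈ V, p.1 < u ∧ u < p.2) ∧ ∃ w ∈ V, w < p.1 ∨ p.2 < w

/-- `p` lies in the closed half-plane of `q` spanned by the vertices between `q.1` and `q.2`. -/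
def Inside (p q : ℕ × ℕ) : Prop := q.1 ≤ p.1 ∧ p.2 ≤ q.2

/-- `p` lies in the closed half-plane of `q` not containing the vertices between the ends. -/
def Outside (p q : ℕ × ℕ) : Prop := p.2 ≤ q.1 ∨ q.2 ≤ p.1 ∨ (p.1 ≤ q.1 ∧ q.2 ≤ p.2)

/-- Subsets of `G` such that no member crosses an element of `G` that is not a member. -/
def CrossClosed (G S : Finset (ℕ × ℕ)) : Prop :=
  S ⊆ G ∧ ∀ p ∈ S, ∀ q ∈ G, Crosses p q → q ∈ S

/-- The crossing graph of `G` is connected. -/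
def CrossConnected (G : Finset (ℕ × ℕ)) : Prop :=
  ∀ S, CrossClosed G S → S.Nonempty → S = G

theorem Crosses.symm {p q : ℕ × ℕ} (h : Crosses p q) : Crosses q p := Or.symm h

theorem crosses_or_inside_or_outside (p q : ℕ × ℕ) :
    Crosses p q ∨ Inside p q ∨ Outside p q := by
  unfold Crosses Inside Outside; omega

theorem Inside.not_crosses_outside {p q d : ℕ × ℕ} (hp : Inside p d)
    (hq : Outside q d) : ¬ Crosses p q := by
  unfold Crosses Inside Outside at *; omega

theorem LcnLE.eq_or_eq {G : Finset (ℕ × ℕ)} (h : LcnLE G 2) {d a b c : ℕ × ℕ}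
    (hd : d ∈ G) (ha : a ∈ G) (hb : b ∈ G) (hc : c ∈ G) (hda : Crosses d a)
    (hdb : Crosses d b) (hdc : Crosses d c) (hab : a ≠ b) : c = a ∨ c = b := by
  by_contra! hne
  have : 2 < (G.filter (fun d' => Crosses d d')).card :=
    Finset.two_lt_card.2 ⟨a, Finset.mem_filter.2 ⟨ha, hda⟩, b, Finset.mem_filter.2 ⟨hb, hdb⟩,
      c, Finset.mem_filter.2 ⟨hc, hdc⟩, hab, hne.1.symm, hne.2.symm⟩
  exact absurd (h d hd) (by omega)

/-- A nonempty proper part of a connected configuration is crossed from outside. -/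
theorem CrossConnected.exists_crosses {G : Finset (ℕ × ℕ)} (h : CrossConnected G)
    (P : ℕ × ℕ → Prop) {a b : ℕ × ℕ} (ha : a ∈ G) (hPa : P a) (hb : b ∈ G) (hPb : ¬ P b) :
    ∃ p ∈ G, P p ∧ ∃ q ∈ G, ¬ P q ∧ Crosses p q := by
  classical
  by_contra! hcon
  have := h (G.filter P) ⟨Finset.filter_subset _ _, fun p hp q hq hpq => by
    rw [Finset.mem_filter] at hp ⊢
    exact ⟨hq, by_contra fun hPq => hcon p hp.1 hp.2 q hq hPq hpq⟩⟩
    ⟨a, Finset.mem_filter.2 ⟨ha, hPa⟩⟩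
  rw [← this, Finset.mem_filter] at hb
  exact hPb hb.2

/-- `p` lies in the closed half-plane of `g` that contains the vertex `v`. -/
def SameSide (v : ℕ) (g p : ℕ × ℕ) : Prop :=
  (g.1 < v ∧ v < g.2 ∧ Inside p g) ∨ (¬ (g.1 < v ∧ v < g.2) ∧ Outside p g)

theorem SameSide.of_crosses {v : ℕ} {x p q : ℕ × ℕ} (h : SameSide v x p)
    (hpq : Crosses p q) (hqx : ¬ Crosses q x) :
    SameSide v x q := by
  rcases crosses_or_inside_or_outside q x with h' | h' | h'
  · exact absurd h' hqx
  · rcases h with ⟨h1, h2, -⟩ | ⟨-, h⟩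
    · exact Or.inl ⟨h1, h2, h'⟩
    · exact absurd hpq.symm (h'.not_crosses_outside h)
  · rcases h with ⟨-, -, h⟩ | ⟨h, -⟩
    · exact absurd hpq (h.not_crosses_outside h')
    · exact Or.inr ⟨h, h'⟩

theorem sameSide_of_endpoint {v : ℕ} {x p d : ℕ × ℕ} (hvd : v = d.1 ∨ v = d.2) (hx : x.1 < x.2)
    (hp : p.1 < p.2) (hxd : Crosses x d) (hpx : ¬ Crosses p x) (hvp : v = p.1 ∨ v = p.2) :
    SameSide v x p := by
  rcases crosses_or_inside_or_outside p x with h | h | h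
  · exact absurd h hpx
  · refine Or.inl ?_
    unfold Inside Crosses at *
    omega
  · refine Or.inr ?_
    unfold Outside Crosses at *
    omega

/-- Of two diagonals crossing `d`, only one can separate the other from an end of `d`. -/
theorem SameSide.not_symm {v : ℕ} {g g' d : ℕ × ℕ} (h : SameSide v g g')
    (hvd : v = d.1 ∨ v = d.2) (hg : g.1 < g.2) (hg' : g'.1 < g'.2)
    (hne : ¬ (g.1 = g'.1 ∧ g.2 = g'.2)) (hgd : Crosses g d) (hgd' : Crosses g' d) :
    ¬ SameSide v g' g := by
  intro h'
  unfold SameSide Inside Outside at *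
  unfold Crosses at hgd hgd'
  rcases hvd with rfl | rfl <;> rcases hgd with hgd | hgd <;> rcases hgd' with hgd' | hgd' <;>
    omega

/-- In a connected configuration where every diagonal is crossed at most twice, no diagonal lies
between two others that share one of its ends. -/
theorem CrossConnected.not_middle {G : Finset (ℕ × ℕ)} (hcon : CrossConnected G)
    (hl : LcnLE G 2) (hlt : ∀ p ∈ G, p.1 < p.2) {v : ℕ} {d l r : ℕ × ℕ} (hd : d ∈ G)
    (hlG : l ∈ G) (hrG : r ∈ G) (hld : l ≠ d) (hrd : r ≠ d) (hlI : Inside l d)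
    (hrO : Outside r d) (hvd : v = d.1 ∨ v = d.2) (hvl : v = l.1 ∨ v = l.2)
    (hvr : v = r.1 ∨ v = r.2) : False := by
  have hdlt := hlt d hd
  have cls : ∀ p ∈ G, Crosses p d ∨ p = d ∨ (Inside p d ∧ p ≠ d) ∨ (Outside p d ∧ p ≠ d) := by
    intro p hp
    have := crosses_or_inside_or_outside p d
    tauto
  have irr : ∀ p : ℕ × ℕ, Inside p d → ¬ Crosses p d := by
    intro p; unfold Inside Crosses; omega
  have orr : ∀ p : ℕ × ℕ, Outside p d → ¬ Crosses p d := by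
    intro p; unfold Outside Crosses; omega
  have drr : ¬ Crosses d d := by unfold Crosses; omega
  obtain ⟨i, hiG, ⟨hiI, hid⟩, g, hgG, hgI, hig⟩ :=
    hcon.exists_crosses (fun p => Inside p d ∧ p ≠ d) hlG ⟨hlI, hld⟩ hd (by simp)
  obtain ⟨o, hoG, ⟨hoO, hod⟩, g', hgG', hgO, hog⟩ :=
    hcon.exists_crosses (fun p => Outside p d ∧ p ≠ d) hrG ⟨hrO, hrd⟩ hd (by simp)
  have hgd : Crosses g d := by
    rcases cls g hgG with h | rfl | h | h
    · exact h
    · exact absurd hig (irr _ hiI)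
    · exact absurd h hgI
    · exact absurd hig (hiI.not_crosses_outside h.1)
  have hgd' : Crosses g' d := by
    rcases cls g' hgG' with h | rfl | h | h
    · exact h
    · exact absurd hog (orr _ hoO)
    · exact absurd hog.symm (h.1.not_crosses_outside hoO)
    · exact absurd h hgO
  have hio : i ≠ o := by
    rintro rfl
    have h1 := hlt i hiG
    apply hid
    unfold Inside Outside at *
    ext <;> omega
  have nbr : ∀ x ∈ G, Crosses g x → x = d ∨ x = i := fun x hx hc =>
    hl.eq_or_eq hgG hd hiG hx hgd hig.symm hc hid.symm
  have nbr' : ∀ x ∈ G, Crosses g' x → x = d ∨ x = o := fun x hx hc =>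
    hl.eq_or_eq hgG' hd hoG hx hgd' hog.symm hc hod.symm
  have hgg : g ≠ g' := by
    rintro rfl
    rcases nbr o hoG hog.symm with h | h
    · exact hod h
    · exact hio h.symm
  have hX : ∀ p ∈ G, Crosses p d → p = g ∨ p = g' := fun p hp hc =>
    hl.eq_or_eq hd hgG hgG' hp hgd.symm hgd'.symm hc.symm hgg
  have hnc : ¬ Crosses g g' := by
    intro h
    rcases nbr g' hgG' h with h | h
    · exact drr (h ▸ hgd')
    · exact irr _ hiI (h ▸ hgd')
  have hgO' : ∀ p ∈ G, Outside p d → p ≠ d → ¬ Crosses p g := by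
    intro p hp hpO hpd hc
    rcases nbr p hp hc.symm with h | rfl
    · exact hpd h
    · have h1 := hlt p hp
      apply hpd
      unfold Inside Outside at *
      ext <;> omega
  have hgI' : ∀ p ∈ G, Inside p d → p ≠ d → ¬ Crosses p g' := by
    intro p hp hpO hpd hc
    rcases nbr' p hp hc.symm with h | rfl
    · exact hpd h
    · have h1 := hlt p hp
      apply hpd
      unfold Inside Outside at *
      ext <;> omega
  have near : SameSide v g g' := by
    obtain ⟨p, hp, ⟨hpO, hpd, hps⟩, q, hq, hqn, hpq⟩ :=
      hcon.exists_crosses (fun p => Outside p d ∧ p ≠ d ∧ SameSide v g p) hrG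
        ⟨hrO, hrd, sameSide_of_endpoint hvd (hlt g hgG) (hlt r hrG) hgd (hgO' r hrG hrO hrd) hvr⟩ hd (by simp)
    rcases cls q hq with h | rfl | h | h
    · rcases hX q hq h with rfl | rfl
      · exact absurd hpq (hgO' p hp hpO hpd)
      · exact hps.of_crosses hpq fun h => hnc h.symm
    · exact absurd hpq (orr _ hpO)
    · exact absurd hpq.symm (h.1.not_crosses_outside hpO)
    · exact absurd ⟨h.1, h.2, hps.of_crosses hpq
        (hgO' q hq h.1 h.2)⟩ hqn
  have near' : SameSide v g' g := by
    obtain ⟨p, hp, ⟨hpI, hpd, hps⟩, q, hq, hqn, hpq⟩ :=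
      hcon.exists_crosses (fun p => Inside p d ∧ p ≠ d ∧ SameSide v g' p) hlG
        ⟨hlI, hld, sameSide_of_endpoint hvd (hlt g' hgG') (hlt l hlG) hgd' (hgI' l hlG hlI hld) hvl⟩ hd (by simp)
    rcases cls q hq with h | rfl | h | h
    · rcases hX q hq h with rfl | rfl
      · exact hps.of_crosses hpq hnc
      · exact absurd hpq (hgI' p hp hpI hpd)
    · exact absurd hpq (irr _ hpI)
    · exact absurd ⟨h.1, h.2, hps.of_crosses hpq
        (hgI' q hq h.1 h.2)⟩ hqn
    · exact absurd hpq (hpI.not_crosses_outside h.1)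
  exact near.not_symm hvd (hlt g hgG) (hlt g' hgG')
    (fun h => hgg (Prod.ext_iff.2 h)) hgd hgd' near'

theorem CrossConnected.card_incident_le_two {G : Finset (ℕ × ℕ)} (hcon : CrossConnected G)
    (hl : LcnLE G 2) (hlt : ∀ p ∈ G, p.1 < p.2) (v : ℕ) :
    (G.filter (fun p => v = p.1 ∨ v = p.2)).card ≤ 2 := by
  by_contra! h
  obtain ⟨a, ha, b, hb, c, hc, hab, hac, hbc⟩ := Finset.two_lt_card.1 h
  rw [Finset.mem_filter] at ha hb hc
  have key : ∀ {d l r : ℕ × ℕ}, (d ∈ G ∧ (v = d.1 ∨ v = d.2)) → (l ∈ G ∧ (v = l.1 ∨ v = l.2)) →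
      (r ∈ G ∧ (v = r.1 ∨ v = r.2)) → l ≠ d → r ≠ d → ¬ (Inside l d ∧ Outside r d) :=
    fun hd hl' hr h1 h2 h3 => hcon.not_middle hl hlt hd.1 hl'.1 hr.1 h1 h2 h3.1 h3.2 hd.2 hl'.2 hr.2
  have k1 := key ha hb hc hab.symm hac.symm
  have k2 := key ha hc hb hac.symm hab.symm
  have k3 := key hb ha hc hab hbc.symm
  have k4 := key hb hc ha hbc.symm hab
  have k5 := key hc ha hb hac hbc
  have k6 := key hc hb ha hbc hac
  have la := hlt a ha.1
  have lb := hlt b hb.1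
  have lc := hlt c hc.1
  obtain ⟨-, ha⟩ := ha
  obtain ⟨-, hb⟩ := hb
  obtain ⟨-, hc⟩ := hc
  obtain ⟨a1, a2⟩ := a
  obtain ⟨b1, b2⟩ := b
  obtain ⟨c1, c2⟩ := c
  simp only [ne_eq, Prod.mk.injEq, Inside, Outside] at *
  clear key
  rcases ha with rfl | rfl <;> rcases hb with rfl | rfl <;> rcases hc with rfl | rfl <;> omega

theorem CrossConnected.card_le {V : Finset ℕ} {G : Finset (ℕ × ℕ)} (hcon : CrossConnected G)
    (hl : LcnLE G 2) (hG : ∀ p ∈ G, IsDiagOf V p) : G.card ≤ V.card := by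
  classical
  have hlt : ∀ p ∈ G, p.1 < p.2 := fun p hp => (hG p hp).2.2.1
  have := Finset.card_mul_le_card_mul (s := G) (t := V) (m := 2) (n := 2)
    (fun p v => v = p.1 ∨ v = p.2) (by
      intro p hp
      rw [← Finset.card_pair (hlt p hp).ne]
      apply Finset.card_le_card
      intro v hv
      obtain ⟨h1, h2, -⟩ := hG p hp
      rw [Finset.mem_bipartiteAbove]
      simp only [Finset.mem_insert, Finset.mem_singleton] at hv
      refine ⟨?_, hv⟩
      rcases hv with rfl | rfl <;> assumption) (fun v _ => by
      unfold Finset.bipartiteBelow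
      exact hcon.card_incident_le_two hl hlt v)
  omega

/-- If every diagonal of the polygon is crossed by `G`, then `G` is connected. -/
theorem crossConnected_of_forall_crossed {V : Finset ℕ} {G : Finset (ℕ × ℕ)}
    (hG : ∀ p ∈ G, IsDiagOf V p) (hX : ∀ p, IsDiagOf V p → ∃ q ∈ G, Crosses p q) :
    CrossConnected G := by
  classical
  intro S₀ hS₀ hne₀
  obtain ⟨C, hC₀, hmin⟩ := Finset.exists_min_image
    (G.powerset.filter fun S => CrossClosed G S ∧ S.Nonempty ∧ S ⊆ S₀) Finset.card
    ⟨S₀, by simp [hS₀, hne₀, hS₀.1]⟩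
  simp only [Finset.mem_filter, Finset.mem_powerset] at hC₀ hmin
  obtain ⟨-, hC, hne, hCS⟩ := hC₀
  have oneSide : ∀ g ∈ G, g ∉ C → (∀ p ∈ C, Inside p g) ∨ (∀ p ∈ C, Outside p g) := by
    intro g hg hgC
    have hcls : ∀ p ∈ C, Inside p g ∨ Outside p g := by
      intro p hp
      rcases crosses_or_inside_or_outside p g with h | h
      · exact absurd (hC.2 p hp g hg h) hgC
      · exact h
    by_cases hI : ∃ p ∈ C, Inside p g
    · left
      obtain ⟨p₀, hp₀, hI⟩ := hI
      have hsub : C.filter (fun p => Inside p g) ⊆ C := Finset.filter_subset _ _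
      have := hmin (C.filter fun p => Inside p g) ⟨hsub.trans hC.1, ⟨hsub.trans hC.1, by
        intro p hp q hq hpq
        rw [Finset.mem_filter] at hp ⊢
        have hqC := hC.2 p hp.1 q hq hpq
        refine ⟨hqC, (hcls q hqC).resolve_right fun h => hp.2.not_crosses_outside h hpq⟩⟩,
        ⟨p₀, Finset.mem_filter.2 ⟨hp₀, hI⟩⟩, hsub.trans hCS⟩
      rw [← Finset.eq_of_subset_of_card_le hsub this]
      intro p hp
      exact (Finset.mem_filter.1 hp).2
    · right
      intro p hp
      exact (hcls p hp).resolve_left fun h => hI ⟨p, hp, h⟩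
  have noncross : ∀ g ∈ G, g ∉ C → ∀ p ∈ C, ∀ q ∈ C, ∀ u w, (u = p.1 ∨ u = p.2) →
      (w = q.1 ∨ w = q.2) → g.1 < u → u < g.2 → (w < g.1 ∨ g.2 < w) → False := by
    intro g hg hgC p hp q hq u w hu hw h1 h2 h3
    have l1 := (hG p (hC.1 hp)).2.2.1
    have l2 := (hG q (hC.1 hq)).2.2.1
    rcases oneSide g hg hgC with h | h
    · have := h q hq
      unfold Inside at this
      omega
    · have := h p hp
      unfold Outside at this
      omega
  obtain ⟨e, he⟩ := hne
  obtain ⟨e', he'G, hee⟩ := hX e (hG e (hC.1 he))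
  have he' := hC.2 e he e' he'G hee
  have hcover : ∀ v ∈ V, ∃ p ∈ C, v = p.1 ∨ v = p.2 := by
    intro v hv
    by_contra! hvC
    set W := C.image Prod.fst ∪ C.image Prod.snd with hW
    have memW : ∀ x, x ∈ W ↔ ∃ p ∈ C, x = p.1 ∨ x = p.2 := by
      intro x
      simp only [hW, Finset.mem_union, Finset.mem_image]
      constructor
      · rintro (⟨p, hp, rfl⟩ | ⟨p, hp, rfl⟩)
        · exact ⟨p, hp, Or.inl rfl⟩
        · exact ⟨p, hp, Or.inr rfl⟩
      · rintro ⟨p, hp, rfl | rfl⟩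
        · exact Or.inl ⟨p, hp, rfl⟩
        · exact Or.inr ⟨p, hp, rfl⟩
    have hWV : W ⊆ V := by
      intro x hx
      obtain ⟨p, hp, rfl | rfl⟩ := (memW x).1 hx
      · exact (hG p (hC.1 hp)).1
      · exact (hG p (hC.1 hp)).2.1
    have hvW : v ∉ W := fun h => by
      obtain ⟨p, hp, h⟩ := (memW v).1 h
      have := hvC p hp
      tauto
    have w1 : e.1 ∈ W := (memW _).2 ⟨e, he, Or.inl rfl⟩
    have w2 : e.2 ∈ W := (memW _).2 ⟨e, he, Or.inr rfl⟩
    have w3 : e'.1 ∈ W := (memW _).2 ⟨e', he', Or.inl rfl⟩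
    have w4 : e'.2 ∈ W := (memW _).2 ⟨e', he', Or.inr rfl⟩
    have fin : ∀ a ∈ W, ∀ b ∈ W, a < b → IsDiagOf V (a, b) →
        ((∀ x ∈ W, ¬ (a < x ∧ x < b)) ∨ (∀ x ∈ W, a ≤ x ∧ x ≤ b)) → False := by
      intro a ha b hb hab hdiag hor
      obtain ⟨g, hg, hcr⟩ := hX _ hdiag
      obtain ⟨p, hp, hpa⟩ := (memW a).1 ha
      obtain ⟨q, hq, hqb⟩ := (memW b).1 hb
      by_cases hgC : g ∈ C
      · have g1 : g.1 ∈ W := (memW _).2 ⟨g, hgC, Or.inl rfl⟩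
        have g2 : g.2 ∈ W := (memW _).2 ⟨g, hgC, Or.inr rfl⟩
        unfold Crosses at hcr
        rcases hor with h | h
        · have := h _ g1
          have := h _ g2
          simp only at hcr
          omega
        · have := h _ g1
          have := h _ g2
          simp only at hcr
          omega
      · unfold Crosses at hcr
        simp only at hcr
        rcases hcr with h | h
        · exact noncross g hg hgC q hq p hp b a hqb hpa (by omega) (by omega) (by omega)
        · exact noncross g hg hgC p hp q hq a b hpa hqb (by omega) (by omega) (by omega)
    unfold Crosses at hee
    by_cases hbtw : (∃ x ∈ W, x < v) ∧ (∃ x ∈ W, v < x)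
    · obtain ⟨⟨x, hx, hxv⟩, ⟨y, hy, hvy⟩⟩ := hbtw
      obtain ⟨a, ha, hamax⟩ := Finset.exists_max_image (W.filter (· < v)) id
        ⟨x, Finset.mem_filter.2 ⟨hx, hxv⟩⟩
      obtain ⟨b, hb, hbmin⟩ := Finset.exists_min_image (W.filter (v < ·)) id
        ⟨y, Finset.mem_filter.2 ⟨hy, hvy⟩⟩
      simp only [Finset.mem_filter, id] at ha hb hamax hbmin
      have hemp : ∀ x ∈ W, ¬ (a < x ∧ x < b) := by
        rintro z hz ⟨h1, h2⟩
        rcases lt_trichotomy z v with h | rfl | h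
        · have := hamax z ⟨hz, h⟩
          omega
        · exact hvW hz
        · have := hbmin z ⟨hz, h⟩
          omega
      refine fin a ha.1 b hb.1 (by omega) ⟨hWV ha.1, hWV hb.1, by simp only; omega,
        ⟨v, hv, ha.2, hb.2⟩, ?_⟩ (Or.inl hemp)
      by_contra! hno
      have n1 := hno _ (hWV w1)
      have n2 := hno _ (hWV w2)
      have n3 := hno _ (hWV w3)
      have n4 := hno _ (hWV w4)
      have m1 := hemp _ w1
      have m2 := hemp _ w2
      have m3 := hemp _ w3
      have m4 := hemp _ w4
      simp only at n1 n2 n3 n4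
      omega
    · obtain ⟨a, ha, hamin⟩ := Finset.exists_min_image W id ⟨_, w1⟩
      obtain ⟨b, hb, hbmax⟩ := Finset.exists_max_image W id ⟨_, w1⟩
      simp only [id] at hamin hbmax
      have n1 := hamin _ w1
      have n2 := hamin _ w2
      have n3 := hamin _ w3
      have n4 := hamin _ w4
      have m1 := hbmax _ w1
      have m2 := hbmax _ w2
      have m3 := hbmax _ w3
      have m4 := hbmax _ w4
      refine fin a ha b hb (by omega) ⟨hWV ha, hWV hb, by simp only; omega, ?_, v, hv, ?_⟩
        (Or.inr fun x hx => ⟨hamin x hx, hbmax x hx⟩)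
      · rcases hee with h | h
        · exact ⟨e'.1, hWV w3, by simp only; omega⟩
        · exact ⟨e.1, hWV w1, by simp only; omega⟩
      · simp only
        by_contra! hno
        have hav : a ≠ v := fun h => hvW (h ▸ ha)
        have hbv : b ≠ v := fun h => hvW (h ▸ hb)
        exact hbtw ⟨⟨a, ha, by omega⟩, ⟨b, hb, by omega⟩⟩
  refine hS₀.1.antisymm fun g hg => ?_
  by_contra hgS
  have hgC : g ∉ C := fun h => hgS (hCS h)
  obtain ⟨-, -, -, ⟨u, huV, hu1, hu2⟩, w, hwV, hw⟩ := hG g hg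
  obtain ⟨p, hp, hpu⟩ := hcover u huV
  obtain ⟨q, hq, hqw⟩ := hcover w hwV
  exact noncross g hg hgC p hp q hq u w hpu hqw hu1 hu2 hw

/-- Cutting along an uncrossed diagonal. -/
theorem card_le_of_uncrossed {V : Finset ℕ} {G : Finset (ℕ × ℕ)} {d : ℕ × ℕ}
    (hG : ∀ p ∈ G, IsDiagOf V p) (hl : LcnLE G 2) (hd : IsDiagOf V d)
    (hunc : ∀ q ∈ G, ¬ Crosses d q) :
    ∃ V₁ V₂ : Finset ℕ, ∃ G₁ G₂ : Finset (ℕ × ℕ), V₁.card + V₂.card = V.card + 2 ∧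
      3 ≤ V₁.card ∧ 3 ≤ V₂.card ∧ (∀ p ∈ G₁, IsDiagOf V₁ p) ∧ (∀ p ∈ G₂, IsDiagOf V₂ p) ∧
      LcnLE G₁ 2 ∧ LcnLE G₂ 2 ∧ G.card ≤ G₁.card + G₂.card + 1 := by
  classical
  obtain ⟨hd1, hd2, hdlt, ⟨u, huV, hu1, hu2⟩, w, hwV, hw⟩ := hd
  have mono : ∀ S ⊆ G, LcnLE S 2 := fun S hS p hp =>
    (Finset.card_le_card (Finset.filter_subset_filter _ hS)).trans (hl p (hS hp))
  refine ⟨V.filter (fun x => d.1 ≤ x ∧ x ≤ d.2), V.filter (fun x => x ≤ d.1 ∨ d.2 ≤ x),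
    G.filter (fun p => p ≠ d ∧ Inside p d), G.filter (fun p => p ≠ d ∧ Outside p d),
    ?_, ?_, ?_, ?_, ?_, mono _ (Finset.filter_subset _ _),
    mono _ (Finset.filter_subset _ _), ?_⟩
  · rw [← Finset.card_union_add_card_inter, ← Finset.filter_or, ← Finset.filter_and]
    congr 1
    · congr 1
      exact Finset.filter_true_of_mem fun x _ => by omega
    · rw [← Finset.card_pair hdlt.ne]
      congr 1
      ext x
      simp only [Finset.mem_filter, Finset.mem_insert, Finset.mem_singleton]
      constructor
      · rintro ⟨-, h⟩
        omega
      · rintro (rfl | rfl)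
        · exact ⟨hd1, by omega⟩
        · exact ⟨hd2, by omega⟩
  · exact Finset.two_lt_card.2 ⟨d.1, by simp [hd1]; omega, u, by simp [huV]; omega, d.2,
      by simp [hd2]; omega, by omega, by omega, by omega⟩
  · exact Finset.two_lt_card.2 ⟨d.1, by simp [hd1], w, by simp [hwV]; omega, d.2,
      by simp [hd2], by omega, by omega, by omega⟩
  · intro p hp
    obtain ⟨hpG, hpd, h1, h2⟩ := Finset.mem_filter.1 hp
    obtain ⟨p1, p2, plt, ⟨x, hx, hx1, hx2⟩, -⟩ := hG p hpG
    refine ⟨Finset.mem_filter.2 ⟨p1, by omega⟩, Finset.mem_filter.2 ⟨p2, by omega⟩, plt,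
      ⟨x, Finset.mem_filter.2 ⟨hx, by omega⟩, hx1, hx2⟩, ?_⟩
    by_cases h : d.1 < p.1
    · exact ⟨d.1, Finset.mem_filter.2 ⟨hd1, by omega⟩, Or.inl h⟩
    · have : p.2 ≠ d.2 := fun h' => hpd (Prod.ext (by omega) h')
      exact ⟨d.2, Finset.mem_filter.2 ⟨hd2, by omega⟩, by omega⟩
  · intro p hp
    obtain ⟨hpG, hpd, hpO⟩ := Finset.mem_filter.1 hp
    unfold Outside at hpO
    obtain ⟨p1, p2, plt, ⟨x, hx, hx1, hx2⟩, y, hy, hy'⟩ := hG p hpG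
    refine ⟨Finset.mem_filter.2 ⟨p1, by omega⟩, Finset.mem_filter.2 ⟨p2, by omega⟩, plt, ?_, ?_⟩
    · by_cases h1 : p.1 < d.1 ∧ d.1 < p.2
      · exact ⟨d.1, Finset.mem_filter.2 ⟨hd1, by omega⟩, h1⟩
      · by_cases h2 : p.1 < d.2 ∧ d.2 < p.2
        · exact ⟨d.2, Finset.mem_filter.2 ⟨hd2, by omega⟩, h2⟩
        · have : p.1 ≠ d.1 ∨ p.2 ≠ d.2 := by
            by_contra! h
            exact hpd (Prod.ext h.1 h.2)
          exact ⟨x, Finset.mem_filter.2 ⟨hx, by omega⟩, hx1, hx2⟩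
    · rcases hpO with h | h | h
      · exact ⟨d.2, Finset.mem_filter.2 ⟨hd2, by omega⟩, by omega⟩
      · exact ⟨d.1, Finset.mem_filter.2 ⟨hd1, by omega⟩, by omega⟩
      · exact ⟨y, Finset.mem_filter.2 ⟨hy, by omega⟩, hy'⟩
  · have hsub : G ⊆ (G.filter (fun p => p ≠ d ∧ Inside p d) ∪
        G.filter (fun p => p ≠ d ∧ Outside p d)) ∪ {d} := by
      intro p hp
      simp only [Finset.mem_union, Finset.mem_filter, Finset.mem_singleton]
      have h1 := crosses_or_inside_or_outside p d
      have h2 : ¬ Crosses p d := fun h => hunc p hp h.symm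
      tauto
    refine (Finset.card_le_card hsub).trans ((Finset.card_union_le _ _).trans ?_)
    rw [Finset.card_singleton]
    exact Nat.add_le_add_right (Finset.card_union_le _ _) 1

/-- A quadrilateral has only two diagonals. -/
theorem card_le_two_of_card_le_four {V : Finset ℕ} {G : Finset (ℕ × ℕ)} {d e : ℕ × ℕ}
    (hV : V.card ≤ 4) (hG : ∀ p ∈ G, IsDiagOf V p) (hd : IsDiagOf V d) (he : IsDiagOf V e)
    (hde : Crosses d e) : V.card = 4 ∧ G.card ≤ 2 := by
  classical
  obtain ⟨d1, d2, dlt, -⟩ := hd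
  obtain ⟨e1, e2, elt, -⟩ := he
  have hcard : ({d.1, d.2, e.1, e.2} : Finset ℕ).card = 4 := by
    unfold Crosses at hde
    repeat rw [Finset.card_insert_of_notMem (by
      simp only [Finset.mem_insert, Finset.mem_singleton]; omega)]
    rfl
  have hsub : ({d.1, d.2, e.1, e.2} : Finset ℕ) ⊆ V := by
    intro x hx
    simp only [Finset.mem_insert, Finset.mem_singleton] at hx
    rcases hx with rfl | rfl | rfl | rfl <;> assumption
  have heq := Finset.eq_of_subset_of_card_le hsub (by omega)
  refine ⟨by rw [← heq, hcard], (Finset.card_le_card fun p hp => ?_).trans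
    (Finset.card_le_two (a := d) (b := e))⟩
  obtain ⟨p1, p2, plt, ⟨u, hu, hu'⟩, w, hw, hw'⟩ := hG p hp
  rw [← heq] at p1 p2 hu hw
  unfold Crosses at hde
  simp only [Finset.mem_insert, Finset.mem_singleton, Prod.ext_iff] at p1 p2 hu hw ⊢
  omega

theorem card_le_of_lcnLE_two (n : ℕ) (hn : 3 ≤ n) (V : Finset ℕ) (hV : V.card = n)
    (G : Finset (ℕ × ℕ)) (hG : ∀ p ∈ G, IsDiagOf V p) (hl : LcnLE G 2) :
    G.card ≤ 2 * (n - 3) + (if n % 3 = 2 then 1 else 0) := by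
  induction n using Nat.strong_induction_on generalizing V G with
  | _ n ih =>
    by_cases hX : ∀ p, IsDiagOf V p → ∃ q ∈ G, Crosses p q
    · rcases G.eq_empty_or_nonempty with rfl | ⟨d, hd⟩
      · simp
      · have hle := (crossConnected_of_forall_crossed hG hX).card_le hl hG
        obtain ⟨e, he, hde⟩ := hX d (hG d hd)
        by_cases h4 : V.card ≤ 4
        · obtain ⟨h1, h2⟩ := card_le_two_of_card_le_four h4 hG (hG d hd) (hG e he) hde
          omega
        · split_ifs <;> omega
    · push Not at hX
      obtain ⟨d, hd, hunc⟩ := hX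
      obtain ⟨V₁, V₂, G₁, G₂, hc, h1, h2, hG₁, hG₂, hl₁, hl₂, hle⟩ :=
        card_le_of_uncrossed hG hl hd hunc
      have i1 := ih V₁.card (by omega) h1 V₁ rfl G₁ hG₁ hl₁
      have i2 := ih V₂.card (by omega) h2 V₂ rfl G₂ hG₂ hl₂
      split_ifs at * <;> omega

theorem IsDiag.isDiagOf {n : ℕ} {p : ℕ × ℕ} (h : IsDiag n p) :
    IsDiagOf (Finset.Icc 1 n) p := by
  unfold IsDiag at h
  simp only [IsDiagOf, Finset.mem_Icc]
  refine ⟨by omega, by omega, by omega, ⟨p.1 + 1, by omega⟩, ?_⟩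
  by_cases h1 : p.1 = 1
  · exact ⟨n, by omega⟩
  · exact ⟨1, by omega⟩

theorem stmt8 (n : ℕ) (hn : 3 ≤ n) :
    IsGreatest {m : ℕ | ∃ G : Finset (ℕ × ℕ), (∀ p ∈ G, IsDiag n p) ∧
      LcnLE G 2 ∧ G.card = m}
      (2 * (n - 3) + (if n % 3 = 2 then 1 else 0)) := by
  refine ⟨exists_lcnLE_two_card_eq n hn, ?_⟩
  rintro m ⟨G, hG, hl, rfl⟩
  exact card_le_of_lcnLE_two n hn (Finset.Icc 1 n) (by simp) G
    (fun p hp => (hG p hp).isDiagOf) hl
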